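/- Let G be a centrally decomposable finite group, let K be a subgroup of G not contained in the centre Z(G), and let L be a nontrivial normal subgroup of G. Then there exist a normal subgroup H of G and a maximal normal subgroup M of L such that H is not contained in M and K is not contained in H. -/

import Mathlib

open scoped Pointwise

/-- The centraliser `C_G(A/B)` of a section: the set of `g ∈ G` with `[g,A] ≤ B`. -/
def relCent {G : Type*} [Group G] (A B : Subgroup G) : Set G :=
  {g : G | ∀ a ∈ A, g * a * g⁻¹ * a⁻¹ ∈ B}

/-- `(A,B)` is a critical pair in the group `G`: `A`, `B` are normal, `B < A`, and every
normal subgroup of `G` properly contained in `A` is contained in `B`. -/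
def CriticalPair {G : Type*} [Group G] (A B : Subgroup G) : Prop :=
  A.Normal ∧ B.Normal ∧ B < A ∧ ∀ N : Subgroup G, N.Normal → N < A → N ≤ B

/-- Critical pair of closed normal subgroups in a topological group. -/
def ClosedCriticalPair {G : Type*} [Group G] [TopologicalSpace G] (A B : Subgroup G) : Prop :=
  A.Normal ∧ B.Normal ∧ IsClosed (A : Set G) ∧ IsClosed (B : Set G) ∧ B < A ∧
    ∀ N : Subgroup G, N.Normal → IsClosed (N : Set G) → N < A → N ≤ B

/-- A topological group is just infinite if it is infinite and every nontrivial
closed normal subgroup has finite index. -/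
def JustInfinite (G : Type*) [Group G] [TopologicalSpace G] : Prop :=
  Infinite G ∧ ∀ N : Subgroup G, N.Normal → IsClosed (N : Set G) → N ≠ ⊥ → N.FiniteIndex

/-- Hereditarily just infinite: just infinite, and every open subgroup is just infinite. -/
def HereditarilyJustInfinite (G : Type*) [Group G] [TopologicalSpace G] : Prop :=
  JustInfinite G ∧ ∀ H : Subgroup G, IsOpen (H : Set G) → JustInfinite ↥H

/-- A profinite group is pronilpotent iff all of its finite continuous quotients,
i.e. quotients by open normal subgroups, are nilpotent. -/
def IsPronilpotent (G : Type*) [Group G] [TopologicalSpace G] : Prop :=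
  ∀ N : Subgroup G, ∀ _ : N.Normal, IsOpen (N : Set G) → Group.IsNilpotent (G ⧸ N)

def VirtuallyPronilpotent (G : Type*) [Group G] [TopologicalSpace G] : Prop :=
  ∃ H : Subgroup G, IsOpen (H : Set G) ∧ IsPronilpotent ↥H

/-- A profinite group is pro-`p` iff all of its quotients by open normal subgroups
are `p`-groups. -/
def IsProP (G : Type*) [Group G] [TopologicalSpace G] (p : ℕ) : Prop :=
  ∀ N : Subgroup G, ∀ _ : N.Normal, IsOpen (N : Set G) → IsPGroup p (G ⧸ N)

def VirtuallyProP (G : Type*) [Group G] [TopologicalSpace G] (p : ℕ) : Prop :=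
  ∃ H : Subgroup G, IsOpen (H : Set G) ∧ IsProP ↥H p

/-- The conjugate `gUg⁻¹` of a subgroup. -/
def conjSub {G : Type*} [Group G] (g : G) (U : Subgroup G) : Subgroup G :=
  U.map (MulAut.conj g).toMonoidHom

/-- The distinct conjugates of `U` centralise each other. -/
def ConjugatesCommute {G : Type*} [Group G] (U : Subgroup G) : Prop :=
  ∀ g h : G, conjSub g U ≠ conjSub h U →
    ∀ x ∈ conjSub g U, ∀ y ∈ conjSub h U, x * y = y * x

/-- `M` is a normal subgroup of the subgroup `L`. -/
def NormalIn {G : Type*} [Group G] (M L : Subgroup G) : Prop :=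
  M ≤ L ∧ ∀ l ∈ L, ∀ m ∈ M, l * m * l⁻¹ ∈ M

/-- `M` is a maximal normal subgroup of the subgroup `L`. -/
def MaximalNormalIn {G : Type*} [Group G] (M L : Subgroup G) : Prop :=
  NormalIn M L ∧ M < L ∧ ∀ M' : Subgroup G, NormalIn M' L → M' < L → M ≤ M' → M = M'

/-- A group is centrally decomposable if it is the central product of a family of
proper subgroups: the subgroups generate, and distinct members commute elementwise. -/
def CentrallyDecomposable (G : Type*) [Group G] : Prop :=
  ∃ (I : Type) (H : I → Subgroup G), (∀ i, H i ≠ ⊤) ∧ (⨆ i, H i) = ⊤ ∧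
    ∀ i j, i ≠ j → ∀ x ∈ H i, ∀ y ∈ H j, x * y = y * x

/-- The Schur multiplier `H₂(S,ℤ)` of a group, via Hopf's formula
`(R ∩ [F,F]) / [F,R]` for the presentation `S = F/R`, `F` the free group on `S`. -/
def SchurMultiplier (S : Type*) [Group S] : Type _ :=
  letI R : Subgroup (FreeGroup S) := (FreeGroup.lift (id : S → S)).ker
  ↥(R ⊓ ⁅(⊤ : Subgroup (FreeGroup S)), (⊤ : Subgroup (FreeGroup S))⁆) ⧸
    ((⁅(⊤ : Subgroup (FreeGroup S)), R⁆).subgroupOf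
      (R ⊓ ⁅(⊤ : Subgroup (FreeGroup S)), (⊤ : Subgroup (FreeGroup S))⁆))

/-- `Q` has a composition series in which at least `n` of the factors lie in the
class `C` of (isomorphism types of) finite simple groups. A factor `s i.succ / s i.castSucc`
is encoded by a surjection from `s i.succ` with kernel `s i.castSucc`. -/
def HasCompSeriesWithFactorsIn (Q : Type) [Group Q]
    (C : (S : Type) → [inst : Group S] → Prop) (n : ℕ) : Prop :=
  ∃ (m : ℕ) (s : Fin (m + 1) → Subgroup Q), Monotone s ∧ s 0 = ⊥ ∧ s (Fin.last m) = ⊤ ∧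
    (∀ i : Fin m, ∃ (S : Type) (_ : Group S) (φ : ↥(s i.succ) →* S),
      Function.Surjective φ ∧ φ.ker = (s i.castSucc).subgroupOf (s i.succ) ∧
      IsSimpleGroup S) ∧
    ∃ T : Finset (Fin m), n ≤ T.card ∧ ∀ i ∈ T,
      ∃ (S : Type) (_ : Group S) (φ : ↥(s i.succ) →* S),
        Function.Surjective φ ∧ φ.ker = (s i.castSucc).subgroupOf (s i.succ) ∧
        IsSimpleGroup S ∧ C S

/-- In a finite group, a proper normal subgroup of `L` lies in a maximal normal subgroup of `L`. -/
theorem NormalIn.exists_le_maximalNormalIn {G : Type*} [Group G] [Finite G] {N L : Subgroup G}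
    (hN : NormalIn N L) (hlt : N < L) : ∃ M, MaximalNormalIn M L ∧ N ≤ M := by
  obtain ⟨M, hNM, hM⟩ := (Set.toFinite {M : Subgroup G | NormalIn M L ∧ M < L}).exists_le_maximal
    (show N ∈ {M : Subgroup G | NormalIn M L ∧ M < L} from ⟨hN, hlt⟩)
  exact ⟨M, ⟨hM.prop.1, hM.prop.2, fun M' h₁ h₂ hle => le_antisymm hle (hM.2 ⟨h₁, h₂⟩ hle)⟩, hNM⟩

/-- If `G = AB` with `B` a proper normal subgroup, then every nontrivial normal subgroup `L` of `G`
has a maximal normal subgroup not containing `A`. -/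
theorem exists_maximalNormalIn_not_ge {G : Type*} [Group G] [Finite G] {A B L : Subgroup G}
    (hB : B.Normal) (hAB : A ⊔ B = ⊤) (hBtop : B ≠ ⊤) (hLn : L.Normal) (hL : L ≠ ⊥) :
    ∃ M, MaximalNormalIn M L ∧ ¬ A ≤ M := by
  by_cases hLB : L ≤ B
  · obtain ⟨M, hM, -⟩ := NormalIn.exists_le_maximalNormalIn (N := ⊥) (L := L)
      ⟨bot_le, fun l _ m hm => by simp_all⟩ (bot_lt_iff_ne_bot.mpr hL)
    refine ⟨M, hM, fun hAM => hBtop ?_⟩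
    rw [← hAB, eq_comm, sup_eq_right]
    exact hAM.trans (hM.1.1.trans hLB)
  · obtain ⟨M, hM, hle⟩ := NormalIn.exists_le_maximalNormalIn (N := L ⊓ B) (L := L)
      ⟨inf_le_left, fun l _ m hm => ⟨hLn.conj_mem m hm.1 l, hB.conj_mem m hm.2 l⟩⟩
      (inf_lt_left.mpr hLB)
    refine ⟨M, hM, fun hAM => hM.2.1.not_ge fun x hx => ?_⟩
    obtain ⟨a, ha, b, hb, rfl⟩ :=
      Subgroup.mem_sup_of_normal_right.mp (hAB ▸ Subgroup.mem_top x : x ∈ A ⊔ B)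
    have haM := hAM ha
    exact mul_mem haM (hle ⟨(Subgroup.mul_mem_cancel_left L (hM.1.1 haM)).mp hx, hb⟩)

/-- A nonabelian centrally decomposable group is the product of a proper normal subgroup `A`
and its centraliser, which is proper as well. -/
theorem CentrallyDecomposable.exists_sup_centralizer_eq_top {G : Type*} [Group G]
    (hG : CentrallyDecomposable G) (hZ : Subgroup.center G ≠ ⊤) :
    ∃ A : Subgroup G, A.Normal ∧ A ≠ ⊤ ∧ Subgroup.centralizer (A : Set G) ≠ ⊤ ∧
      A ⊔ Subgroup.centralizer (A : Set G) = ⊤ := by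
  obtain ⟨I, H, hne, hsup, hcomm⟩ := hG
  obtain ⟨i, hi⟩ : ∃ i, ¬ H i ≤ Subgroup.center G := by
    by_contra! h
    exact hZ (top_le_iff.mp (hsup ▸ iSup_le h))
  have htop : H i ⊔ Subgroup.centralizer (H i : Set G) = ⊤ := by
    rw [eq_top_iff, ← hsup]
    refine iSup_le fun j => ?_
    by_cases hij : i = j
    · exact hij ▸ le_sup_left
    · exact le_sup_of_le_right fun y hy =>
        Subgroup.mem_centralizer_iff.mpr fun x hx => hcomm i j hij x hx y hy
  refine ⟨H i, ?_, hne i, fun h => hi (Subgroup.centralizer_eq_top_iff_subset.mp h), htop⟩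
  rw [← Subgroup.normalizer_eq_top_iff, eq_top_iff, ← htop]
  exact sup_le Subgroup.le_normalizer (Subgroup.centralizer_le_normalizer _)

/-- if `G` is a centrally decomposable finite group, `K` a non-central
subgroup and `L` a nontrivial normal subgroup, then there exist a normal subgroup `H` of
`G` and a maximal normal subgroup `M` of `L` such that `H ⊄ M` and `K ⊄ H`. -/
theorem stmt9 {G : Type*} [Group G] [Finite G] (hG : CentrallyDecomposable G)
    (K : Subgroup G) (hK : ¬ K ≤ Subgroup.center G)
    (L : Subgroup G) (hLn : L.Normal) (hL : L ≠ ⊥) :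
    ∃ H M : Subgroup G, H.Normal ∧ MaximalNormalIn M L ∧ ¬ H ≤ M ∧ ¬ K ≤ H := by
  have hZ : Subgroup.center G ≠ ⊤ := fun h => hK (h ▸ le_top)
  obtain ⟨A, hA, hAtop, hCtop, hsup⟩ := hG.exists_sup_centralizer_eq_top hZ
  have hC : (Subgroup.centralizer (A : Set G)).Normal := inferInstance
  by_cases hKA : K ≤ A
  · obtain ⟨M, hM, hCM⟩ :=
      exists_maximalNormalIn_not_ge hA (sup_comm A _ ▸ hsup) hAtop hLn hL
    refine ⟨_, M, hC, hM, hCM, fun hKC => hK ?_⟩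
    rw [← SetLike.coe_subset_coe, ← Subgroup.centralizer_eq_top_iff_subset, eq_top_iff, ← hsup]
    exact sup_le (Subgroup.le_centralizer_iff.mp hKC) (Subgroup.centralizer_le hKA)
  · obtain ⟨M, hM, hAM⟩ := exists_maximalNormalIn_not_ge hC hsup hCtop hLn hL
    exact ⟨A, M, hA, hM, hAM, hKA⟩
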